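/- Let Ω be a finite nonempty set and ρ a probability operator on L²(Ω) with q-measure μ_ρ. Then μ_ρ is grade-2 additive: for any mutually disjoint subsets A, B, C of Ω, μ_ρ(A ∪ B ∪ C) = μ_ρ(A ∪ B) + μ_ρ(A ∪ C) + μ_ρ(B ∪ C) − μ_ρ(A) − μ_ρ(B) − μ_ρ(C). -/

import Mathlib

open scoped Classical ComplexOrder

noncomputable section

/-- The inner product on `L²(Ω)` for a finite set `Ω`, conjugate-linear in the
first argument: `⟨f,g⟩ = Σ_ω conj (f ω) * g ω`. -/
def ip {Ω : Type} [Fintype Ω] (f g : Ω → ℂ) : ℂ := ∑ ω, (starRingEnd ℂ) (f ω) * g ω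

/-- The characteristic function `χ_A` of `A ⊆ Ω`. -/
def chi {Ω : Type} (A : Set Ω) : Ω → ℂ := A.indicator fun _ => 1

/-- The decoherence functional `D_ρ(A,B) = ⟨ρ χ_B, χ_A⟩` of an operator `ρ`. -/
def Dfun {Ω : Type} [Fintype Ω] (ρ : (Ω → ℂ) →ₗ[ℂ] (Ω → ℂ)) (A B : Set Ω) : ℂ :=
  ip (ρ (chi B)) (chi A)

lemma ip_add_left {Ω : Type} [Fintype Ω] (f g h : Ω → ℂ) : ip (f + g) h = ip f h + ip g h := by
  simp [ip, add_mul, Finset.sum_add_distrib]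

lemma ip_add_right {Ω : Type} [Fintype Ω] (f g h : Ω → ℂ) : ip f (g + h) = ip f g + ip f h := by
  simp [ip, mul_add, Finset.sum_add_distrib]

lemma chi_union {Ω : Type} {A B : Set Ω} (h : Disjoint A B) : chi (A ∪ B) = chi A + chi B :=
  Set.indicator_union_of_disjoint h _

/-- The q-measure `μ_ρ(A) = D_ρ(A,A)` of a probability operator is grade-2 additive:
for mutually disjoint `A`, `B`, `C`,
`μ(A∪B∪C) = μ(A∪B) + μ(A∪C) + μ(B∪C) − μ(A) − μ(B) − μ(C)`. -/
theorem qMeasure_grade_two_additive (Ω : Type) [Fintype Ω] [Nonempty Ω]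
    (ρ : (Ω → ℂ) →ₗ[ℂ] (Ω → ℂ))
    (hpos : ∀ f : Ω → ℂ, 0 ≤ ip (ρ f) f)
    (hnorm : ip (ρ fun _ => 1) (fun _ => 1) = 1)
    (A B C : Set Ω) (hAB : A ∩ B = ∅) (hAC : A ∩ C = ∅) (hBC : B ∩ C = ∅) :
    Dfun ρ (A ∪ B ∪ C) (A ∪ B ∪ C) =
      Dfun ρ (A ∪ B) (A ∪ B) + Dfun ρ (A ∪ C) (A ∪ C) + Dfun ρ (B ∪ C) (B ∪ C)
        - Dfun ρ A A - Dfun ρ B B - Dfun ρ C C := by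
  rw [← Set.disjoint_iff_inter_eq_empty] at hAB hAC hBC
  simp only [Dfun, chi_union (hAC.union_left hBC), chi_union hAB, chi_union hAC, chi_union hBC,
    map_add, ip_add_left, ip_add_right]
  ring

end
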